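/- Let ε > 0 and let T ≥ 1 be an integer with T ≥ log(n) / log((1+ε)²). Then the optimal value γ* := γ*(G_T, M^T) of the semidefinite program applied to the lifted system S(G_T, M^T) satisfies ρ̂(G, M) ≤ (γ*)^{1/T} ≤ (1 + ε) · ρ̂(G, M). -/

import Mathlib

open Filter Matrix

/-- The operator norm on `n × n` real matrices induced by the Euclidean norm on `ℝ^n`. -/
noncomputable def euclOpNorm {n : ℕ} (A : Matrix (Fin n) (Fin n) ℝ) : ℝ :=
  ‖LinearMap.toContinuousLinearMap (Matrix.toEuclideanLin A)‖

/-- The Euclidean norm on `ℝ^n`. -/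
noncomputable def euclNorm {n : ℕ} (x : Fin n → ℝ) : ℝ :=
  Real.sqrt (∑ i, x i ^ 2)

/-- The matrix product `A_{σ(t-1)} ⋯ A_{σ(0)}` associated to a sequence of labels `σ`. -/
noncomputable def pathProd {n N : ℕ} (A : Fin N → Matrix (Fin n) (Fin n) ℝ)
    (t : ℕ) (σ : Fin t → Fin N) : Matrix (Fin n) (Fin n) ℝ :=
  (List.ofFn fun i => A (σ i)).reverse.prod

/-- `v, σ` describe a path of length `t` in the labeled graph with edge set `E`:
its `i`-th edge goes from node `v i` to node `v (i+1)` and carries the label `σ i`. -/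
def IsPath {V : Type*} {N : ℕ} (E : Set (V × V × Fin N)) {t : ℕ}
    (v : Fin (t + 1) → V) (σ : Fin t → Fin N) : Prop :=
  ∀ i : Fin t, (v i.castSucc, v i.succ, σ i) ∈ E

/-- The labeled graph with edge set `E` is strongly connected: any node can be joined to
any node by a path of length at least 1. -/
def StronglyConnected {V : Type*} {N : ℕ} (E : Set (V × V × Fin N)) : Prop :=
  ∀ u w : V, ∃ (t : ℕ) (v : Fin (t + 1) → V) (σ : Fin t → Fin N),
    1 ≤ t ∧ IsPath E v σ ∧ v 0 = u ∧ v (Fin.last t) = w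

/-- The constrained joint spectral radius of the system `S(G, M)` with `G = (V, E)`, `M = A`. -/
noncomputable def cjsr {V : Type*} {n N : ℕ} (E : Set (V × V × Fin N))
    (A : Fin N → Matrix (Fin n) (Fin n) ℝ) : ℝ :=
  Filter.atTop.limsup fun t : ℕ =>
    sSup { x : ℝ | ∃ (v : Fin (t + 1) → V) (σ : Fin t → Fin N),
      IsPath E v σ ∧ x = euclOpNorm (pathProd A t σ) ^ (1 / (t : ℝ)) }

/-- The constrained joint spectral radius of the `T`-lifted system `S(G_T, M^T)`:
paths of length `k` in `G_T` are exactly paths of length `k * T` in `G`. -/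
noncomputable def cjsrLift {V : Type*} {n N : ℕ} (E : Set (V × V × Fin N))
    (A : Fin N → Matrix (Fin n) (Fin n) ℝ) (T : ℕ) : ℝ :=
  Filter.atTop.limsup fun k : ℕ =>
    sSup { x : ℝ | ∃ (v : Fin (k * T + 1) → V) (σ : Fin (k * T) → Fin N),
      IsPath E v σ ∧ x = euclOpNorm (pathProd A (k * T) σ) ^ (1 / (k : ℝ)) }

/-- Stability of the constrained switching system: along every infinite path of the graph,
every trajectory converges to `0`. -/
def Stable {V : Type*} {n N : ℕ} (E : Set (V × V × Fin N))
    (A : Fin N → Matrix (Fin n) (Fin n) ℝ) : Prop :=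
  ∀ (v : ℕ → V) (σ : ℕ → Fin N), (∀ t : ℕ, (v t, v (t + 1), σ t) ∈ E) →
    ∀ x0 : Fin n → ℝ,
      Tendsto (fun t : ℕ => (pathProd A t fun i : Fin t => σ i).mulVec x0)
        atTop (nhds 0)

/-- `ν` is a family of norms on `ℝ^n` indexed by the nodes. -/
def IsNormFamily {V : Type*} {n : ℕ} (ν : V → (Fin n → ℝ) → ℝ) : Prop :=
  ∀ u : V,
    (∀ x y : Fin n → ℝ, ν u (x + y) ≤ ν u x + ν u y) ∧
    (∀ (a : ℝ) (x : Fin n → ℝ), ν u (a • x) = |a| * ν u x) ∧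
    (∀ x : Fin n → ℝ, ν u x = 0 → x = 0)

/-- `ν` is a `γ`-multinorm for the system `S(G, M)`. -/
def IsMultinorm {V : Type*} {n N : ℕ} (E : Set (V × V × Fin N))
    (A : Fin N → Matrix (Fin n) (Fin n) ℝ) (γ : ℝ)
    (ν : V → (Fin n → ℝ) → ℝ) : Prop :=
  IsNormFamily ν ∧
    ∀ vi vj : V, ∀ σ : Fin N, (vi, vj, σ) ∈ E →
      ∀ x : Fin n → ℝ, ν vj ((A σ).mulVec x) ≤ γ * ν vi x

/-- `Q` is a quadratic `γ`-multinorm for the system `S(G, M)`. -/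
def IsQuadMultinorm {V : Type*} {n N : ℕ} (E : Set (V × V × Fin N))
    (A : Fin N → Matrix (Fin n) (Fin n) ℝ) (γ : ℝ)
    (Q : V → Matrix (Fin n) (Fin n) ℝ) : Prop :=
  (∀ u : V, (Q u).PosDef) ∧
    ∀ vi vj : V, ∀ σ : Fin N, (vi, vj, σ) ∈ E →
      (γ ^ 2 • Q vi - (A σ)ᵀ * Q vj * A σ).PosSemidef

/-- `Q` is a quadratic `γ`-multinorm for the lifted system `S(G_T, M^T)`: the Loewner
inequality holds along every path of length `T` of `G` (i.e. every edge of `G_T`). -/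
def IsQuadMultinormLift {V : Type*} {n N : ℕ} (E : Set (V × V × Fin N))
    (A : Fin N → Matrix (Fin n) (Fin n) ℝ) (T : ℕ) (γ : ℝ)
    (Q : V → Matrix (Fin n) (Fin n) ℝ) : Prop :=
  (∀ u : V, (Q u).PosDef) ∧
    ∀ (v : Fin (T + 1) → V) (σ : Fin T → Fin N), IsPath E v σ →
      (γ ^ 2 • Q (v 0) -
        (pathProd A T σ)ᵀ * Q (v (Fin.last T)) * pathProd A T σ).PosSemidef

/-- `Q` is a path-dependent Lyapunov function with memory `T` for `S(G, M)`:
one positive definite quadratic form per path of length `T`, with a strict decrease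
condition along every path of length `T + 1`. -/
def IsPathDepLyap {V : Type*} {n N : ℕ} (E : Set (V × V × Fin N))
    (A : Fin N → Matrix (Fin n) (Fin n) ℝ) (T : ℕ)
    (Q : (Fin (T + 1) → V) → (Fin T → Fin N) → Matrix (Fin n) (Fin n) ℝ) : Prop :=
  (∀ (v : Fin (T + 1) → V) (σ : Fin T → Fin N), IsPath E v σ → (Q v σ).PosDef) ∧
    ∀ (v : Fin (T + 2) → V) (σ : Fin (T + 1) → Fin N), IsPath E v σ →
      (Q (fun i : Fin (T + 1) => v i.castSucc) (fun i : Fin T => σ i.castSucc) -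
        (A (σ (Fin.last T)))ᵀ *
          Q (fun i : Fin (T + 1) => v i.succ) (fun i : Fin T => σ i.succ) *
            A (σ (Fin.last T))).PosDef

/-- The joint spectral radius of a finite set of matrices (arbitrary switching). -/
noncomputable def jsr {n N : ℕ} (A : Fin N → Matrix (Fin n) (Fin n) ℝ) : ℝ :=
  Filter.atTop.limsup fun t : ℕ =>
    sSup { x : ℝ | ∃ σ : Fin t → Fin N,
      x = euclOpNorm (pathProd A t σ) ^ (1 / (t : ℝ)) }

/-- The joint spectral radius of the set `M^T` of all products of `T` matrices from `M`:
products of `k` matrices from `M^T` are exactly products of `k * T` matrices from `M`. -/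
noncomputable def jsrPow {n N : ℕ} (A : Fin N → Matrix (Fin n) (Fin n) ℝ) (T : ℕ) : ℝ :=
  Filter.atTop.limsup fun k : ℕ =>
    sSup { x : ℝ | ∃ σ : Fin (k * T) → Fin N,
      x = euclOpNorm (pathProd A (k * T) σ) ^ (1 / (k : ℝ)) }

/-- The optimal value `γ*(G, M)` of the semidefinite program of Corollary 4.6. -/
noncomputable def gammaStar {V : Type*} {n N : ℕ} (E : Set (V × V × Fin N))
    (A : Fin N → Matrix (Fin n) (Fin n) ℝ) : ℝ :=
  sInf {γ : ℝ | 0 < γ ∧ ∃ Q : V → Matrix (Fin n) (Fin n) ℝ,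
    (∀ u : V, (Q u).PosDef) ∧ ∀ vi vj : V, ∀ σ : Fin N, (vi, vj, σ) ∈ E →
      (γ ^ 2 • Q vi - (A σ)ᵀ * Q vj * A σ).PosDef}

/-- The optimal value `γ*(G_T, M^T)` of the semidefinite program applied to the lifted
system `S(G_T, M^T)`. -/
noncomputable def gammaStarLift {V : Type*} {n N : ℕ} (E : Set (V × V × Fin N))
    (A : Fin N → Matrix (Fin n) (Fin n) ℝ) (T : ℕ) : ℝ :=
  sInf {γ : ℝ | 0 < γ ∧ ∃ Q : V → Matrix (Fin n) (Fin n) ℝ,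
    (∀ u : V, (Q u).PosDef) ∧
      ∀ (v : Fin (T + 1) → V) (σ : Fin T → Fin N), IsPath E v σ →
        (γ ^ 2 • Q (v 0) -
          (pathProd A T σ)ᵀ * Q (v (Fin.last T)) * pathProd A T σ).PosDef}

lemma quad_cauchy {n : ℕ} (B : Matrix (Fin n) (Fin n) ℝ) (hs : Bᵀ = B)
    (hp : ∀ y, 0 ≤ y ⬝ᵥ (B *ᵥ y)) (z y : Fin n → ℝ) :
    (z ⬝ᵥ (B *ᵥ y)) ^ 2 ≤ (z ⬝ᵥ (B *ᵥ z)) * (y ⬝ᵥ (B *ᵥ y)) := by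
  have hsym : y ⬝ᵥ (B *ᵥ z) = z ⬝ᵥ (B *ᵥ y) := by
    rw [dotProduct_mulVec, ← mulVec_transpose, hs, dotProduct_comm]
  have h : ∀ a : ℝ, 0 ≤ (z ⬝ᵥ (B *ᵥ z)) * (a * a) + (2 * (z ⬝ᵥ (B *ᵥ y))) * a
      + y ⬝ᵥ (B *ᵥ y) := by
    intro a
    have := hp (a • z + y)
    simp only [mulVec_add, mulVec_smul, dotProduct_add, add_dotProduct, smul_dotProduct,
      dotProduct_smul, smul_eq_mul, hsym] at this
    linarith
  have := discrim_le_zero h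
  unfold discrim at this
  nlinarith

lemma bern_aux (m : ℕ) (q : ℝ)
    (h : ∀ s : ℝ, 0 < s → s < 1 → (1 - s) ^ m * ((1 - s) + s * q) ≤ 1) : q ≤ m + 1 := by
  by_contra hq
  push Not at hq
  have hm : (0 : ℝ) ≤ m := Nat.cast_nonneg m
  have hq1 : 0 < q - 1 := by linarith
  set d := q - 1 - m with hd
  have hd0 : 0 < d := by linarith
  set s := d / (2 * (m + 1) * (q - 1)) with hs
  have hden : 0 < 2 * ((m : ℝ) + 1) * (q - 1) := by positivity
  have hs0 : 0 < s := by positivity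
  have hsd : s * (2 * (m + 1) * (q - 1)) = d := by rw [hs]; field_simp
  have hs1 : s < 1 := by
    rw [hs, div_lt_one hden]; nlinarith
  have h1 := h s hs0 hs1
  have h2 : 1 + (m : ℝ) * (-s) ≤ (1 + -s) ^ m := one_add_mul_le_pow (by linarith) m
  have h3 : 0 < (1 - s) + s * q := by nlinarith
  have h4 : (1 + (m : ℝ) * (-s)) * ((1 - s) + s * q) ≤ 1 := by
    refine le_trans (mul_le_mul_of_nonneg_right h2 h3.le) ?_
    simpa [sub_eq_add_neg] using h1
  have h5 : s * (d - m * (q - 1) * s) ≤ 0 := by rw [hd]; nlinarith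
  have h6 : d - m * (q - 1) * s ≤ 0 := by
    by_contra hc
    push Not at hc
    nlinarith [mul_pos hs0 hc]
  have h7 : 0 < (q - 1) * s := by positivity
  nlinarith

lemma dot_vecMulVec {n : ℕ} (x y : Fin n → ℝ) :
    y ⬝ᵥ (vecMulVec x x *ᵥ y) = (x ⬝ᵥ y) ^ 2 := by
  rw [vecMulVec_mulVec]
  simp [dotProduct_comm y x, sq]

/-- A Kiefer-Wolfowitz / John type theorem. -/
lemma john {n : ℕ} (hn : 1 ≤ n) (S : Set (Fin n → ℝ)) (R : ℝ)
    (hS : ∀ x ∈ S, ∀ i, |x i| ≤ R) (he : ∀ i, Pi.single i (1 : ℝ) ∈ S) :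
    ∃ B : Matrix (Fin n) (Fin n) ℝ, B.PosDef ∧
      (∀ x ∈ S, ∀ y, (x ⬝ᵥ y) ^ 2 ≤ n * (y ⬝ᵥ (B *ᵥ y))) ∧
      (∀ y c, (∀ x ∈ S, (x ⬝ᵥ y) ^ 2 ≤ c) → y ⬝ᵥ (B *ᵥ y) ≤ c) := by
  classical
  set C : Set (Matrix (Fin n) (Fin n) ℝ) := {B | Bᵀ = B ∧ (∀ y, 0 ≤ y ⬝ᵥ (B *ᵥ y)) ∧
    (∀ y c, (∀ x ∈ S, (x ⬝ᵥ y) ^ 2 ≤ c) → y ⬝ᵥ (B *ᵥ y) ≤ c)} with hC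
  have hcont : ∀ y : Fin n → ℝ, Continuous fun B : Matrix (Fin n) (Fin n) ℝ => y ⬝ᵥ (B *ᵥ y) := by
    intro y; fun_prop
  have hclosed : IsClosed C := by
    rw [hC]
    simp only [Set.ofPred_and, Set.ofPred_forall]
    refine IsClosed.inter (isClosed_eq (by fun_prop) (by fun_prop)) (IsClosed.inter ?_ ?_)
    · exact isClosed_iInter fun y => isClosed_le continuous_const (hcont y)
    · exact isClosed_iInter fun y => isClosed_iInter fun c => isClosed_iInter fun _ =>
        isClosed_le (hcont y) continuous_const
  have hentry : ∀ B ∈ C, ∀ i j, |B i j| ≤ 4 * R ^ 2 := by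
    rintro B ⟨hs, hp, hb⟩ i j
    have hR : ∀ x ∈ S, ∀ i, -R ≤ x i ∧ x i ≤ R := fun x hx i => abs_le.1 (hS x hx i)
    have e1 : ∀ i j, (Pi.single i (1 : ℝ) : Fin n → ℝ) ⬝ᵥ (B *ᵥ Pi.single j 1) = B i j := by
      intro i j; simp
    have hd : ∀ i, 0 ≤ B i i ∧ B i i ≤ R ^ 2 := by
      intro i
      rw [← e1 i i]
      refine ⟨hp _, hb _ _ fun x hx => ?_⟩
      simp only [dotProduct_single, mul_one]
      have := hR x hx i
      nlinarith
    have hij : 0 ≤ B i i + B j j + 2 * B i j ∧ B i i + B j j + 2 * B i j ≤ 4 * R ^ 2 := by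
      have hsym : B j i = B i j := by
        conv_lhs => rw [← hs]
        rfl
      have e2 : ((Pi.single i (1 : ℝ) : Fin n → ℝ) + Pi.single j 1) ⬝ᵥ
          (B *ᵥ (Pi.single i 1 + Pi.single j 1)) = B i i + B j j + 2 * B i j := by
        rw [mulVec_add, dotProduct_add, add_dotProduct, add_dotProduct, e1, e1, e1, e1, hsym]
        ring
      rw [← e2]
      refine ⟨hp _, hb _ _ fun x hx => ?_⟩
      simp only [dotProduct_add, dotProduct_single, mul_one]
      have h1 := hR x hx i
      have h2 := hR x hx j
      nlinarith
    have h1 := hd i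
    have h2 := hd j
    rw [abs_le]
    constructor <;> nlinarith
  have hcomp : IsCompact C := by
    have hK : IsCompact {B : Fin n → Fin n → ℝ | ∀ i, B i ∈ {b : Fin n → ℝ | ∀ j, b j ∈
        Set.Icc (-(4 * R ^ 2)) (4 * R ^ 2)}} :=
      isCompact_pi_infinite fun _ => isCompact_pi_infinite fun _ => isCompact_Icc
    refine IsCompact.of_isClosed_subset hK hclosed ?_
    intro B hB i j
    exact abs_le.1 (hentry B hB i j)
  have hn0 : (0 : ℝ) < n := by exact_mod_cast hn
  have hI : ((1 / n : ℝ) • (1 : Matrix (Fin n) (Fin n) ℝ)) ∈ C := by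
    have hq : ∀ y : Fin n → ℝ, y ⬝ᵥ (((1 / n : ℝ) • (1 : Matrix (Fin n) (Fin n) ℝ)) *ᵥ y)
        = (1 / n) * ∑ i, y i ^ 2 := by
      intro y
      rw [smul_mulVec, one_mulVec, dotProduct_smul, smul_eq_mul]
      simp [dotProduct, sq]
    refine ⟨by simp, fun y => ?_, fun y c hc => ?_⟩
    · rw [hq]; positivity
    · rw [hq]
      have : ∑ i, y i ^ 2 ≤ ∑ _i : Fin n, c := Finset.sum_le_sum fun i _ => by
        simpa using hc _ (he i)
      simp at this
      rw [one_div, inv_mul_le_iff₀ hn0]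
      exact this
  obtain ⟨B, hB, hmax⟩ := hcomp.exists_isMaxOn ⟨_, hI⟩
    (f := fun B => B.det) (Continuous.matrix_det continuous_id).continuousOn
  obtain ⟨hs, hp, hb⟩ := id hB
  have hdet : 0 < B.det := by
    have : ((1 / n : ℝ) • (1 : Matrix (Fin n) (Fin n) ℝ)).det ≤ B.det := hmax hI
    refine lt_of_lt_of_le ?_ this
    rw [det_smul, det_one]; positivity
  have hunit : IsUnit B.det := hdet.ne'.isUnit
  have hsol : ∀ x, B *ᵥ (B⁻¹ *ᵥ x) = x := by
    intro x; rw [mulVec_mulVec, mul_nonsing_inv _ hunit, one_mulVec]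
  have hconv : ∀ x ∈ S, ∀ s : ℝ, 0 < s → s < 1 → ((1 - s) • B + s • vecMulVec x x) ∈ C := by
    intro x hx s h0 h1
    have hq : ∀ y : Fin n → ℝ, y ⬝ᵥ (((1 - s) • B + s • vecMulVec x x) *ᵥ y)
        = (1 - s) * (y ⬝ᵥ (B *ᵥ y)) + s * (x ⬝ᵥ y) ^ 2 := by
      intro y
      rw [add_mulVec, smul_mulVec, smul_mulVec, dotProduct_add, dotProduct_smul, dotProduct_smul,
        dot_vecMulVec]; rfl
    refine ⟨?_, fun y => ?_, fun y c hc => ?_⟩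
    · simp [transpose_add, transpose_smul, hs, transpose_vecMulVec]
    · rw [hq]
      have := hp y
      have : 0 ≤ 1 - s := by linarith
      positivity
    · rw [hq]
      have h2 := hb y c hc
      have h3 := hc x hx
      nlinarith
  have hkey : ∀ x ∈ S, x ⬝ᵥ (B⁻¹ *ᵥ x) ≤ n := by
    intro x hx
    obtain ⟨m, rfl⟩ : ∃ m, n = m + 1 := ⟨n - 1, by omega⟩
    push_cast
    refine bern_aux m _ fun s h0 h1 => ?_
    have h := hmax (hconv x hx s h0 h1)
    have h1s : 1 - s ≠ 0 := by linarith
    have hfac : (1 - s) • B + s • vecMulVec x x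
        = B * ((1 - s) • (1 + vecMulVec ((s / (1 - s)) • (B⁻¹ *ᵥ x)) x)) := by
      rw [mul_smul_comm, mul_add, mul_one, mul_vecMulVec, mulVec_smul, hsol, smul_vecMulVec,
        smul_add, smul_smul, mul_div_cancel₀ _ h1s]
    simp only [Set.mem_ofPred_eq] at h
    rw [hfac, det_mul, det_smul, vecMulVec_eq Unit, det_one_add_replicateCol_mul_replicateRow,
      dotProduct_smul, smul_eq_mul, Fintype.card_fin] at h
    have h2 := (mul_le_iff_le_one_right hdet).1 h
    refine le_trans (le_of_eq ?_) h2
    field_simp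
    ring
  refine ⟨B, ?_, ?_, hb⟩
  · refine PosDef.of_dotProduct_mulVec_pos (by simpa [IsHermitian, conjTranspose_eq_transpose_of_trivial] using hs) ?_
    intro x hx
    rw [star_trivial]
    refine lt_of_le_of_ne (hp x) fun h0 => hx ?_
    have h1 := quad_cauchy B hs hp (B *ᵥ x) x
    rw [← h0, mul_zero] at h1
    have h2 : (B *ᵥ x) ⬝ᵥ (B *ᵥ x) = 0 := by nlinarith
    have h3 := dotProduct_self_eq_zero.1 h2
    have : B⁻¹ *ᵥ (B *ᵥ x) = x := by
      rw [mulVec_mulVec, nonsing_inv_mul _ hunit, one_mulVec]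
    rw [← this, h3, mulVec_zero]
  · intro x hx y
    have h1 := quad_cauchy B hs hp (B⁻¹ *ᵥ x) y
    have h2 : (B⁻¹ *ᵥ x) ⬝ᵥ (B *ᵥ y) = x ⬝ᵥ y := by
      rw [dotProduct_mulVec, ← mulVec_transpose, hs, hsol]
    rw [h2, hsol, dotProduct_comm _ x] at h1
    exact h1.trans (mul_le_mul_of_nonneg_right (hkey x hx) (hp y))

/-- `Reach E A u w t M`: there is a path of length `t` from `u` to `w` with product `M`. -/
inductive Reach {V : Type} {n N : ℕ} (E : Set (V × V × Fin N))
    (A : Fin N → Matrix (Fin n) (Fin n) ℝ) :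
    V → V → ℕ → Matrix (Fin n) (Fin n) ℝ → Prop
  | nil (u : V) : Reach E A u u 0 1
  | cons {u w x : V} {σ : Fin N} {t : ℕ} {M : Matrix (Fin n) (Fin n) ℝ} :
      (u, w, σ) ∈ E → Reach E A w x t M → Reach E A u x (t + 1) (M * A σ)

lemma pathProd_succ {n N : ℕ} (A : Fin N → Matrix (Fin n) (Fin n) ℝ) (t : ℕ)
    (σ : Fin (t + 1) → Fin N) :
    pathProd A (t + 1) σ = pathProd A t (fun i => σ i.succ) * A (σ 0) := by
  simp [pathProd, List.ofFn_succ]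

lemma reach_of_isPath {V : Type} {n N : ℕ} (E : Set (V × V × Fin N))
    (A : Fin N → Matrix (Fin n) (Fin n) ℝ) : ∀ (t : ℕ) (v : Fin (t + 1) → V) (σ : Fin t → Fin N),
    IsPath E v σ → Reach E A (v 0) (v (Fin.last t)) t (pathProd A t σ) := by
  intro t
  induction t with
  | zero =>
    intro v σ _
    have : pathProd A 0 σ = 1 := by simp [pathProd]
    rw [this]
    exact Reach.nil _
  | succ t ih =>
    intro v σ h
    rw [pathProd_succ]
    have h0 := h 0
    have := ih (fun i => v i.succ) (fun i => σ i.succ) (fun i => by simpa using h i.succ)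
    exact Reach.cons h0 this

lemma isPath_of_reach {V : Type} {n N : ℕ} {E : Set (V × V × Fin N)}
    {A : Fin N → Matrix (Fin n) (Fin n) ℝ} {u w : V} {t : ℕ} {M : Matrix (Fin n) (Fin n) ℝ}
    (h : Reach E A u w t M) : ∃ (v : Fin (t + 1) → V) (σ : Fin t → Fin N),
      IsPath E v σ ∧ v 0 = u ∧ v (Fin.last t) = w ∧ M = pathProd A t σ := by
  induction h with
  | nil u => exact ⟨fun _ => u, Fin.elim0, fun i => i.elim0, rfl, rfl, by simp [pathProd]⟩
  | @cons u w x τ t M he _ ih =>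
    obtain ⟨v, σ, hp, h0, h1, hM⟩ := ih
    refine ⟨Fin.cons u v, Fin.cons τ σ, ?_, rfl, ?_, ?_⟩
    · intro i
      refine Fin.cases ?_ (fun i => ?_) i
      · simpa [h0] using he
      · have := hp i
        simpa [← Fin.succ_castSucc] using this
    · rw [← Fin.succ_last]; simpa using h1
    · rw [pathProd_succ]; simp [hM]

lemma Reach.append {V : Type} {n N : ℕ} {E : Set (V × V × Fin N)}
    {A : Fin N → Matrix (Fin n) (Fin n) ℝ} {u w x : V} {s t : ℕ}
    {M M' : Matrix (Fin n) (Fin n) ℝ}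
    (h : Reach E A u w s M) (h' : Reach E A w x t M') : Reach E A u x (s + t) (M' * M) := by
  induction h with
  | nil u => simpa using h'
  | cons he _ ih =>
    have := Reach.cons he (ih h')
    rw [← mul_assoc]
    convert this using 1
    omega

lemma Reach.split {V : Type} {n N : ℕ} {E : Set (V × V × Fin N)}
    {A : Fin N → Matrix (Fin n) (Fin n) ℝ} {x : V} {t : ℕ} : ∀ (s : ℕ) {u : V}
    {M : Matrix (Fin n) (Fin n) ℝ}, Reach E A u x (s + t) M →
    ∃ w M1 M2, Reach E A u w s M1 ∧ Reach E A w x t M2 ∧ M = M2 * M1 := by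
  intro s
  induction s with
  | zero =>
    intro u M h
    rw [zero_add] at h
    exact ⟨u, 1, M, Reach.nil u, h, by simp⟩
  | succ s ih =>
    intro u M h
    have e : s + 1 + t = (s + t) + 1 := by omega
    rw [e] at h
    cases h with
    | cons he h' =>
      obtain ⟨w, M1, M2, h1, h2, rfl⟩ := ih h'
      exact ⟨w, M1 * _, M2, Reach.cons he h1, h2, by rw [mul_assoc]⟩

open scoped Matrix.Norms.L2Operator in
lemma euclOpNorm_mul {n : ℕ} (M M' : Matrix (Fin n) (Fin n) ℝ) :
    euclOpNorm (M * M') ≤ euclOpNorm M * euclOpNorm M' := l2_opNorm_mul M M'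

lemma euclOpNorm_nonneg {n : ℕ} (M : Matrix (Fin n) (Fin n) ℝ) : 0 ≤ euclOpNorm M :=
  norm_nonneg _

lemma norm_sq_toLp {n : ℕ} (y : Fin n → ℝ) : ‖WithLp.toLp 2 y‖ ^ 2 = y ⬝ᵥ y := by
  rw [EuclideanSpace.norm_sq_eq]
  simp [dotProduct, sq]

lemma mulVec_sq_le {n : ℕ} (M : Matrix (Fin n) (Fin n) ℝ) (y : Fin n → ℝ) :
    (M *ᵥ y) ⬝ᵥ (M *ᵥ y) ≤ euclOpNorm M ^ 2 * (y ⬝ᵥ y) := by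
  rw [← norm_sq_toLp, ← norm_sq_toLp, ← mul_pow]
  exact pow_le_pow_left₀ (norm_nonneg _)
    ((LinearMap.toContinuousLinearMap (Matrix.toEuclideanLin M)).le_opNorm (WithLp.toLp 2 y)) 2

lemma euclOpNorm_le {n : ℕ} (M : Matrix (Fin n) (Fin n) ℝ) (K : ℝ) (hK : 0 ≤ K)
    (h : ∀ y, (M *ᵥ y) ⬝ᵥ (M *ᵥ y) ≤ K ^ 2 * (y ⬝ᵥ y)) : euclOpNorm M ≤ K := by
  refine ContinuousLinearMap.opNorm_le_bound _ hK fun y => ?_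
  have := h y.ofLp
  rw [← norm_sq_toLp, ← norm_sq_toLp, ← mul_pow] at this
  exact (pow_le_pow_iff_left₀ (norm_nonneg _) (by positivity) two_ne_zero).1 this

lemma euclOpNorm_one {n : ℕ} : euclOpNorm (1 : Matrix (Fin n) (Fin n) ℝ) ≤ 1 :=
  euclOpNorm_le _ _ zero_le_one (by simp)

lemma entry_le {n : ℕ} (M : Matrix (Fin n) (Fin n) ℝ) (i j : Fin n) :
    |M i j| ≤ euclOpNorm M := by
  have h := mulVec_sq_le M (Pi.single j 1)
  have h1 : M i j ^ 2 ≤ (M *ᵥ Pi.single j 1) ⬝ᵥ (M *ᵥ Pi.single j 1) := by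
    have := Finset.single_le_sum (f := fun i => M i j * M i j)
      (fun i _ => mul_self_nonneg _) (Finset.mem_univ i)
    simpa [dotProduct, sq] using this
  have h2 := h1.trans h
  simp only [dotProduct_single, Pi.single_eq_same, mul_one] at h2
  exact abs_le_of_sq_le_sq h2 (euclOpNorm_nonneg M)

lemma exists_bound {V : Type} {n N : ℕ} (E : Set (V × V × Fin N))
    (A : Fin N → Matrix (Fin n) (Fin n) ℝ) : ∃ K : ℝ, 1 ≤ K ∧
      ∀ u w t M, Reach E A u w t M → euclOpNorm M ≤ K ^ t := by
  have hsum : ∀ i, euclOpNorm (A i) ≤ 1 + ∑ i, euclOpNorm (A i) := fun i => by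
    have := Finset.single_le_sum (f := fun i => euclOpNorm (A i))
      (fun i _ => euclOpNorm_nonneg _) (Finset.mem_univ i)
    linarith
  refine ⟨1 + ∑ i, euclOpNorm (A i), ?_, ?_⟩
  · have : 0 ≤ ∑ i, euclOpNorm (A i) := Finset.sum_nonneg fun i _ => euclOpNorm_nonneg _
    linarith
  · intro u w t M h
    induction h with
    | nil => simpa using euclOpNorm_one
    | @cons u w x τ t M he _ ih =>
      rw [pow_succ]
      exact (euclOpNorm_mul _ _).trans (mul_le_mul ih (hsum τ) (euclOpNorm_nonneg _)
        ((euclOpNorm_nonneg _).trans ih))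

/-- The sequence whose limsup is the CJSR. -/
noncomputable def cseq {V : Type} {n N : ℕ} (E : Set (V × V × Fin N))
    (A : Fin N → Matrix (Fin n) (Fin n) ℝ) (t : ℕ) : ℝ :=
  sSup { x : ℝ | ∃ (v : Fin (t + 1) → V) (σ : Fin t → Fin N),
      IsPath E v σ ∧ x = euclOpNorm (pathProd A t σ) ^ (1 / (t : ℝ)) }

lemma cseq_nonneg {V : Type} {n N : ℕ} (E : Set (V × V × Fin N))
    (A : Fin N → Matrix (Fin n) (Fin n) ℝ) (t : ℕ) : 0 ≤ cseq E A t := by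
  refine Real.sSup_nonneg ?_
  rintro x ⟨v, σ, _, rfl⟩
  exact Real.rpow_nonneg (euclOpNorm_nonneg _) _

lemma root_le {a b : ℝ} {t : ℕ} (ht : t ≠ 0) (ha : 0 ≤ a) (hb : 0 ≤ b) (h : a ≤ b ^ t) :
    a ^ (1 / (t : ℝ)) ≤ b := by
  rw [one_div]
  calc a ^ ((t : ℝ)⁻¹) ≤ (b ^ t) ^ ((t : ℝ)⁻¹) := Real.rpow_le_rpow ha h (by positivity)
    _ = b := Real.pow_rpow_inv_natCast hb ht

lemma cseq_le {V : Type} {n N : ℕ} (E : Set (V × V × Fin N))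
    (A : Fin N → Matrix (Fin n) (Fin n) ℝ) (t : ℕ) (ht : t ≠ 0) (C s : ℝ) (hC : 0 ≤ C)
    (hs : 0 ≤ s) (h : ∀ u w M, Reach E A u w t M → euclOpNorm M ≤ C * s ^ t) :
    cseq E A t ≤ C ^ (1 / (t : ℝ)) * s := by
  refine Real.sSup_le ?_ (by positivity)
  rintro x ⟨v, σ, hp, rfl⟩
  have h1 := h _ _ _ (reach_of_isPath E A t v σ hp)
  refine root_le ht (euclOpNorm_nonneg _) (by positivity) (h1.trans (le_of_eq ?_))
  rw [mul_pow, one_div, Real.rpow_inv_natCast_pow hC ht]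

lemma cseq_bdd {V : Type} {n N : ℕ} (E : Set (V × V × Fin N))
    (A : Fin N → Matrix (Fin n) (Fin n) ℝ) :
    IsBoundedUnder (· ≤ ·) atTop (cseq E A) := by
  obtain ⟨K, hK, h⟩ := exists_bound E A
  refine ⟨K, ?_⟩
  rw [eventually_map]
  filter_upwards [eventually_ne_atTop 0] with t ht
  have := cseq_le E A t ht 1 K zero_le_one (by linarith) (fun u w M hM => by
    simpa using h u w t M hM)
  simpa using this

lemma le_cseq {V : Type} {n N : ℕ} {E : Set (V × V × Fin N)}
    {A : Fin N → Matrix (Fin n) (Fin n) ℝ} {t : ℕ} (ht : t ≠ 0) {u w : V}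
    {M : Matrix (Fin n) (Fin n) ℝ} (hM : Reach E A u w t M) :
    euclOpNorm M ≤ cseq E A t ^ t := by
  obtain ⟨K, hK, h⟩ := exists_bound E A
  obtain ⟨v, σ, hp, -, -, rfl⟩ := isPath_of_reach hM
  have : euclOpNorm (pathProd A t σ) ^ (1 / (t : ℝ)) ≤ cseq E A t := by
    refine le_csSup ⟨K, ?_⟩ ⟨v, σ, hp, rfl⟩
    rintro x ⟨v, σ, hp, rfl⟩
    exact root_le ht (euclOpNorm_nonneg _) (by linarith) (h _ _ _ _ (reach_of_isPath E A t v σ hp))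
  calc euclOpNorm (pathProd A t σ) = (euclOpNorm (pathProd A t σ) ^ (1 / (t : ℝ))) ^ t := by
        rw [one_div, Real.rpow_inv_natCast_pow (euclOpNorm_nonneg _) ht]
    _ ≤ _ := pow_le_pow_left₀ (Real.rpow_nonneg (euclOpNorm_nonneg _) _) this t

lemma cjsr_eq {V : Type} {n N : ℕ} (E : Set (V × V × Fin N))
    (A : Fin N → Matrix (Fin n) (Fin n) ℝ) : cjsr E A = limsup (cseq E A) atTop := rfl

lemma cjsr_nonneg {V : Type} {n N : ℕ} (E : Set (V × V × Fin N))
    (A : Fin N → Matrix (Fin n) (Fin n) ℝ) : 0 ≤ cjsr E A := by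
  rw [cjsr_eq]
  exact le_limsup_of_frequently_le (Frequently.of_forall fun t => cseq_nonneg E A t)
    (cseq_bdd E A)

/-- growth bound from `r > cjsr`. -/
lemma growth {V : Type} {n N : ℕ} (E : Set (V × V × Fin N))
    (A : Fin N → Matrix (Fin n) (Fin n) ℝ) (r : ℝ) (hr : cjsr E A < r) :
    ∃ C : ℝ, ∀ u w t M, Reach E A u w t M → euclOpNorm M ≤ C * r ^ t := by
  have hr0 : 0 < r := (cjsr_nonneg E A).trans_lt hr
  obtain ⟨K, hK, h⟩ := exists_bound E A
  rw [cjsr_eq] at hr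
  obtain ⟨t0, ht0⟩ := eventually_atTop.1 (eventually_lt_of_limsup_lt hr (cseq_bdd E A))
  have hK0 : 0 < K := by linarith
  have hnn : 0 ≤ ∑ t ∈ Finset.range (t0 + 1), (K / r) ^ t :=
    Finset.sum_nonneg fun t _ => by positivity
  refine ⟨1 + ∑ t ∈ Finset.range (t0 + 1), (K / r) ^ t, fun u w t M hM => ?_⟩
  have hrt : 0 < r ^ t := by positivity
  by_cases ht : t < t0 + 1
  · have h1 := h u w t M hM
    have h2 : (K / r) ^ t ≤ ∑ t ∈ Finset.range (t0 + 1), (K / r) ^ t :=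
      Finset.single_le_sum (f := fun t => (K / r) ^ t) (fun t _ => by positivity)
        (Finset.mem_range.2 ht)
    have h3 : K ^ t = (K / r) ^ t * r ^ t := by rw [← mul_pow, div_mul_cancel₀ _ hr0.ne']
    rw [h3] at h1
    nlinarith
  · have h1 := le_cseq (by omega) hM
    have h2 : cseq E A t ^ t ≤ r ^ t :=
      pow_le_pow_left₀ (cseq_nonneg E A t) (ht0 t (by omega)).le t
    nlinarith

lemma cjsr_le_of_growth {V : Type} {n N : ℕ} (E : Set (V × V × Fin N))
    (A : Fin N → Matrix (Fin n) (Fin n) ℝ) (C s : ℝ) (hC : 0 < C) (hs : 0 ≤ s)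
    (h : ∀ u w t M, Reach E A u w t M → euclOpNorm M ≤ C * s ^ t) : cjsr E A ≤ s := by
  have hlim : Tendsto (fun t : ℕ => C ^ (1 / (t : ℝ)) * s) atTop (nhds s) := by
    have h1 : Tendsto (fun t : ℕ => C ^ (1 / (t : ℝ))) atTop (nhds (C ^ (0 : ℝ))) :=
      tendsto_const_nhds.rpow tendsto_one_div_atTop_nhds_zero_nat (Or.inl hC.ne')
    rw [Real.rpow_zero] at h1
    simpa using h1.mul_const s
  rw [cjsr_eq, ← hlim.limsup_eq]
  refine limsup_le_limsup ?_ ?_ hlim.isBoundedUnder_le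
  · filter_upwards [eventually_ne_atTop 0] with t ht
    exact cseq_le E A t ht C s hC.le hs fun u w M hM => h u w t M hM
  · exact IsBoundedUnder.isCoboundedUnder_le ⟨0, eventually_map.2 (Eventually.of_forall fun t => cseq_nonneg E A t)⟩

/-- The SDP feasible set. -/
def feas {V : Type} {n N : ℕ} (E : Set (V × V × Fin N))
    (A : Fin N → Matrix (Fin n) (Fin n) ℝ) (T : ℕ) : Set ℝ :=
  {γ : ℝ | 0 < γ ∧ ∃ Q : V → Matrix (Fin n) (Fin n) ℝ,
    (∀ u : V, (Q u).PosDef) ∧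
      ∀ (v : Fin (T + 1) → V) (σ : Fin T → Fin N), IsPath E v σ →
        (γ ^ 2 • Q (v 0) -
          (pathProd A T σ)ᵀ * Q (v (Fin.last T)) * pathProd A T σ).PosDef}

lemma quad_expand {n : ℕ} (γ : ℝ) (P Q M : Matrix (Fin n) (Fin n) ℝ) (y : Fin n → ℝ) :
    y ⬝ᵥ ((γ ^ 2 • P - Mᵀ * Q * M) *ᵥ y)
      = γ ^ 2 * (y ⬝ᵥ (P *ᵥ y)) - (M *ᵥ y) ⬝ᵥ (Q *ᵥ (M *ᵥ y)) := by
  rw [sub_mulVec, dotProduct_sub, smul_mulVec, dotProduct_smul, smul_eq_mul,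
    ← mulVec_mulVec, ← mulVec_mulVec, dotProduct_mulVec y Mᵀ, vecMul_transpose]

lemma herm_expand {n : ℕ} (γ : ℝ) (P Q M : Matrix (Fin n) (Fin n) ℝ) (hP : P.IsHermitian)
    (hQ : Q.IsHermitian) : (γ ^ 2 • P - Mᵀ * Q * M).IsHermitian := by
  have h1 : Pᵀ = P := by simpa [conjTranspose_eq_transpose_of_trivial] using hP.eq
  have h2 : Qᵀ = Q := by simpa [conjTranspose_eq_transpose_of_trivial] using hQ.eq
  rw [IsHermitian, conjTranspose_eq_transpose_of_trivial]
  simp [transpose_mul, h1, h2, mul_assoc]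

lemma posDef_lower {n : ℕ} (Q : Matrix (Fin n) (Fin n) ℝ) (hQ : Q.PosDef) :
    ∃ c : ℝ, 0 < c ∧ ∀ y, (y ⬝ᵥ y) ≤ c * (y ⬝ᵥ (Q *ᵥ y)) := by
  -- by Cauchy-Schwarz, with `z = Q⁻¹ y`
  have hs : Qᵀ = Q := by simpa [conjTranspose_eq_transpose_of_trivial] using hQ.isHermitian.eq
  have hp : ∀ y, 0 ≤ y ⬝ᵥ (Q *ᵥ y) := fun y => by
    simpa using hQ.posSemidef.dotProduct_mulVec_nonneg y
  have hunit : IsUnit Q.det := (isUnit_iff_isUnit_det Q).1 hQ.isUnit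
  set R := euclOpNorm Q⁻¹ with hR
  have hR0 : 0 ≤ R := euclOpNorm_nonneg _
  refine ⟨R + 1, by linarith, fun y => ?_⟩
  have hy0 : 0 ≤ y ⬝ᵥ y := by
    rw [← norm_sq_toLp]; positivity
  have h1 := quad_cauchy Q hs hp (Q⁻¹ *ᵥ y) y
  have hz : Q *ᵥ (Q⁻¹ *ᵥ y) = y := by rw [mulVec_mulVec, mul_nonsing_inv _ hunit, one_mulVec]
  have h2 : (Q⁻¹ *ᵥ y) ⬝ᵥ (Q *ᵥ y) = y ⬝ᵥ y := by
    rw [dotProduct_mulVec, ← mulVec_transpose, hs, hz]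
  rw [h2, hz] at h1
  have h3 : (Q⁻¹ *ᵥ y) ⬝ᵥ y ≤ R * (y ⬝ᵥ y) := by
    have h4 := quad_cauchy (1 : Matrix (Fin n) (Fin n) ℝ) (by simp)
      (fun y => by rw [one_mulVec, ← norm_sq_toLp]; positivity) (Q⁻¹ *ᵥ y) y
    simp only [one_mulVec] at h4
    have h5 := mulVec_sq_le Q⁻¹ y
    refine (le_abs_self _).trans (abs_le_of_sq_le_sq ?_ (by positivity))
    nlinarith
  have hq := hp y
  rcases hy0.eq_or_lt with h0 | h0
  · rw [← h0]; positivity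
  · have h6 : (y ⬝ᵥ y) * (y ⬝ᵥ y) ≤ (y ⬝ᵥ y) * (R * (y ⬝ᵥ (Q *ᵥ y))) := by nlinarith
    have := le_of_mul_le_mul_left h6 h0
    linarith

lemma lower_bound {V : Type} [Fintype V] {n N : ℕ} (E : Set (V × V × Fin N))
    (A : Fin N → Matrix (Fin n) (Fin n) ℝ) (T : ℕ) (hT : 1 ≤ T) (γ : ℝ) (hγ : γ ∈ feas E A T) :
    cjsr E A ≤ γ ^ (1 / (T : ℝ)) := by
  obtain ⟨hγ0, Q, hQ, hpath⟩ := hγ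
  set s := γ ^ (1 / (T : ℝ)) with hsdef
  have hs0 : 0 < s := Real.rpow_pos_of_pos hγ0 _
  have hsT : s ^ T = γ := by
    rw [hsdef, one_div, Real.rpow_inv_natCast_pow hγ0.le (by omega)]
  obtain ⟨K, hK, hKb⟩ := exists_bound E A
  choose c hc hcq using fun u => posDef_lower (Q u) (hQ u)
  have hqn : ∀ u y, 0 ≤ y ⬝ᵥ (Q u *ᵥ y) := fun u y => by
    simpa using (hQ u).posSemidef.dotProduct_mulVec_nonneg y
  set c' := ∑ u, c u with hc'
  have hc0 : 0 ≤ c' := Finset.sum_nonneg fun u _ => (hc u).le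
  have hcu : ∀ u, c u ≤ c' := fun u =>
    Finset.single_le_sum (f := c) (fun u _ => (hc u).le) (Finset.mem_univ u)
  set D := ∑ t ∈ Finset.range T, (K / s) ^ (2 * t) * c' with hD
  have hKp : 0 < K := by linarith
  have hD0 : 0 ≤ D := Finset.sum_nonneg fun t _ => by positivity
  have main : ∀ t u w M, Reach E A u w t M → ∀ y,
      (M *ᵥ y) ⬝ᵥ (M *ᵥ y) ≤ D * s ^ (2 * t) * (y ⬝ᵥ (Q u *ᵥ y)) := by
    intro t
    induction t using Nat.strong_induction_on with
    | _ t ih =>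
      intro u w M hM y
      by_cases ht : t < T
      · have h1 := mulVec_sq_le M y
        have h2 : euclOpNorm M ^ 2 ≤ K ^ (2 * t) := by
          rw [mul_comm, pow_mul]
          exact pow_le_pow_left₀ (euclOpNorm_nonneg _) (hKb u w t M hM) 2
        have h3 : y ⬝ᵥ y ≤ c' * (y ⬝ᵥ (Q u *ᵥ y)) :=
          (hcq u y).trans (mul_le_mul_of_nonneg_right (hcu u) (hqn u y))
        have h4 : (K / s) ^ (2 * t) * c' ≤ D :=
          Finset.single_le_sum (f := fun t => (K / s) ^ (2 * t) * c') (fun t _ => by positivity)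
            (Finset.mem_range.2 ht)
        have hy0 : 0 ≤ y ⬝ᵥ y := by
          rw [← norm_sq_toLp]; positivity
        calc (M *ᵥ y) ⬝ᵥ (M *ᵥ y) ≤ euclOpNorm M ^ 2 * (y ⬝ᵥ y) := h1
          _ ≤ K ^ (2 * t) * (c' * (y ⬝ᵥ (Q u *ᵥ y))) :=
            mul_le_mul h2 h3 hy0 (by positivity)
          _ = ((K / s) ^ (2 * t) * c') * s ^ (2 * t) * (y ⬝ᵥ (Q u *ᵥ y)) := by
            rw [div_pow]; field_simp
          _ ≤ _ := mul_le_mul_of_nonneg_right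
            (mul_le_mul_of_nonneg_right h4 (by positivity)) (hqn u y)
      · obtain ⟨t', rfl⟩ : ∃ t', t = T + t' := ⟨t - T, by omega⟩
        obtain ⟨x, M1, M2, h1, h2, rfl⟩ := hM.split T
        have h3 := ih t' (by omega) x w M2 h2 (M1 *ᵥ y)
        obtain ⟨v, σ, hp, rfl, rfl, rfl⟩ := isPath_of_reach h1
        have h4 := (hpath v σ hp).posSemidef.dotProduct_mulVec_nonneg y
        rw [star_trivial, quad_expand] at h4
        rw [← mulVec_mulVec]
        refine h3.trans ?_
        have h5 : 0 ≤ D * s ^ (2 * t') := by positivity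
        have h6 := mul_le_mul_of_nonneg_left (sub_nonneg.1 h4) h5
        refine h6.trans (le_of_eq ?_)
        rw [← hsT]
        ring
  -- bound `Q` above
  set q := ∑ u, euclOpNorm (Q u) with hq
  have hqu : ∀ u y, y ⬝ᵥ (Q u *ᵥ y) ≤ (q + 1) * (y ⬝ᵥ y) := by
    intro u y
    have hy0 : 0 ≤ y ⬝ᵥ y := by
      rw [← norm_sq_toLp]; positivity
    have h1 : euclOpNorm (Q u) ≤ q := Finset.single_le_sum (f := fun u => euclOpNorm (Q u))
      (fun u _ => euclOpNorm_nonneg _) (Finset.mem_univ u)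
    have h4 := quad_cauchy (1 : Matrix (Fin n) (Fin n) ℝ) (by simp)
      (fun y => by rw [one_mulVec, ← norm_sq_toLp]; positivity) y (Q u *ᵥ y)
    simp only [one_mulVec] at h4
    have h5 := mulVec_sq_le (Q u) y
    have h0 := euclOpNorm_nonneg (Q u)
    have : y ⬝ᵥ (Q u *ᵥ y) ≤ euclOpNorm (Q u) * (y ⬝ᵥ y) := by
      refine (le_abs_self _).trans (abs_le_of_sq_le_sq ?_ (by positivity))
      nlinarith
    nlinarith
  have hq0 : 0 ≤ q := Finset.sum_nonneg fun u _ => euclOpNorm_nonneg _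
  set C := Real.sqrt (D * (q + 1)) with hCd
  have hC2 : C ^ 2 = D * (q + 1) := Real.sq_sqrt (by positivity)
  have hC0 : 0 ≤ C := Real.sqrt_nonneg _
  refine cjsr_le_of_growth E A (C + 1) s (by positivity) hs0.le fun u w t M hM => ?_
  have : euclOpNorm M ≤ C * s ^ t := by
    refine euclOpNorm_le M _ (by positivity) fun y => ?_
    refine (main t u w M hM y).trans ?_
    have := mul_le_mul_of_nonneg_left (hqu u y) (by positivity : 0 ≤ D * s ^ (2 * t))
    refine this.trans (le_of_eq ?_)
    rw [mul_pow, hC2]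
    ring
  have : 0 < s ^ t := by positivity
  nlinarith

lemma feas_of_gt {V : Type} {n N : ℕ} (hn : 1 ≤ n) (E : Set (V × V × Fin N))
    (A : Fin N → Matrix (Fin n) (Fin n) ℝ) (T : ℕ) (r : ℝ) (hr : cjsr E A < r)
    (γ : ℝ) (hγ0 : 0 < γ) (hγ : n * (r ^ T) ^ 2 < γ ^ 2) : γ ∈ feas E A T := by
  have hr0 : 0 < r := (cjsr_nonneg E A).trans_lt hr
  obtain ⟨C, hC⟩ := growth E A r hr
  let S : V → Set (Fin n → ℝ) := fun u =>
    {x | ∃ w t M i, Reach E A u w t M ∧ x = fun j => (r ^ t)⁻¹ * M i j}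
  have hbd : ∀ u, ∀ x ∈ S u, ∀ i, |x i| ≤ C := by
    rintro u x ⟨w, t, M, i, hM, rfl⟩ j
    have h1 := (entry_le M i j).trans (hC u w t M hM)
    have hrt : 0 < r ^ t := by positivity
    simp only
    rw [abs_mul, abs_of_pos (inv_pos.2 hrt), inv_mul_le_iff₀ hrt]
    linarith
  have hbasis : ∀ u, ∀ i, Pi.single i (1 : ℝ) ∈ S u := by
    intro u i
    refine ⟨u, 0, 1, i, Reach.nil u, ?_⟩
    ext j
    simp [one_apply, Pi.single_apply, eq_comm]
  choose Q hQ hQ1 hQ2 using fun u => john hn (S u) C (hbd u) (hbasis u)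
  refine ⟨hγ0, Q, hQ, fun v σ hp => ?_⟩
  have hM := reach_of_isPath E A T v σ hp
  generalize pathProd A T σ = M at hM
  generalize v 0 = u at hM
  generalize v (Fin.last T) = w at hM
  refine PosDef.of_dotProduct_mulVec_pos (herm_expand _ _ _ _ (hQ u).isHermitian (hQ w).isHermitian) ?_
  intro y hy
  rw [star_trivial, quad_expand]
  have hpos : 0 < y ⬝ᵥ (Q u *ᵥ y) := by simpa using (hQ u).dotProduct_mulVec_pos hy
  have hle : (M *ᵥ y) ⬝ᵥ (Q w *ᵥ (M *ᵥ y)) ≤ n * (r ^ T) ^ 2 * (y ⬝ᵥ (Q u *ᵥ y)) := by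
    refine hQ2 w _ _ ?_
    rintro x ⟨w', t, M', i, hM', rfl⟩
    have hx : (fun j => (r ^ (T + t))⁻¹ * (M' * M) i j) ∈ S u :=
      ⟨w', T + t, M' * M, i, hM.append hM', rfl⟩
    have h1 := hQ1 u _ hx y
    have h2 : (fun j => (r ^ t)⁻¹ * M' i j) ⬝ᵥ (M *ᵥ y)
        = r ^ T * ((fun j => (r ^ (T + t))⁻¹ * (M' * M) i j) ⬝ᵥ y) := by
      have e1 : (fun j => (r ^ t)⁻¹ * M' i j) = (r ^ t)⁻¹ • M' i := rfl
      have e2 : (fun j => (r ^ (T + t))⁻¹ * (M' * M) i j) = (r ^ (T + t))⁻¹ • (M' * M) i := rfl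
      have e3 : M' i ⬝ᵥ (M *ᵥ y) = (M' * M) i ⬝ᵥ y := by
        have : (M' *ᵥ (M *ᵥ y)) i = ((M' * M) *ᵥ y) i := by rw [mulVec_mulVec]
        exact this
      rw [e1, e2, smul_dotProduct, smul_dotProduct, e3, pow_add, smul_eq_mul, smul_eq_mul]
      field_simp
    rw [h2, mul_pow]
    have : 0 ≤ (r ^ T) ^ 2 := by positivity
    nlinarith
  nlinarith

/-- approximation scheme, `ρ̂(G,M) ≤ (γ*(G_T, M^T))^{1/T} ≤ (1+ε) ρ̂(G,M)`. -/
theorem gammaStarLift_bounds {n N : ℕ} (hn : 1 ≤ n) (hN : 1 ≤ N)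
    {V : Type} [Fintype V] [Nonempty V]
    (E : Set (V × V × Fin N)) (A : Fin N → Matrix (Fin n) (Fin n) ℝ)
    (hconn : StronglyConnected E)
    (ε : ℝ) (hε : 0 < ε)
    (T : ℕ) (hT : 1 ≤ T)
    (hTbig : Real.log n / Real.log ((1 + ε) ^ 2) ≤ (T : ℝ)) :
    cjsr E A ≤ gammaStarLift E A T ^ (1 / (T : ℝ)) ∧
      gammaStarLift E A T ^ (1 / (T : ℝ)) ≤ (1 + ε) * cjsr E A := by
  have hT0 : T ≠ 0 := by omega
  have hbb : BddBelow (feas E A T) := ⟨0, fun γ hγ => hγ.1.le⟩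
  have hG : gammaStarLift E A T = sInf (feas E A T) := rfl
  have hG0 : 0 ≤ gammaStarLift E A T := by
    rw [hG]; exact Real.sInf_nonneg fun γ hγ => hγ.1.le
  have hρ := cjsr_nonneg E A
  have hn0 : (0 : ℝ) < n := by exact_mod_cast hn
  have hnT : (n : ℝ) ≤ ((1 + ε) ^ T) ^ 2 := by
    have hl : 0 < Real.log ((1 + ε) ^ 2) := Real.log_pos (by nlinarith)
    rw [div_le_iff₀ hl, ← Real.log_pow] at hTbig
    have := (Real.log_le_log_iff hn0 (by positivity)).1 hTbig
    refine this.trans (le_of_eq ?_)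
    rw [← pow_mul, ← pow_mul, mul_comm]
  have hfe : ∀ r, cjsr E A < r → ((1 + ε) * r) ^ T ∈ feas E A T := by
    intro r hr
    obtain ⟨r', h1, h2⟩ := exists_between hr
    have hr' : 0 < r' := hρ.trans_lt h1
    have hr0 : 0 < r := hr'.trans h2
    refine feas_of_gt hn E A T r' h1 _ (by positivity) ?_
    rw [mul_pow, mul_pow]
    have h3 : (r' ^ T) ^ 2 < (r ^ T) ^ 2 :=
      pow_lt_pow_left₀ (pow_lt_pow_left₀ h2 hr'.le hT0) (by positivity) two_ne_zero
    calc (n : ℝ) * (r' ^ T) ^ 2 < n * (r ^ T) ^ 2 := mul_lt_mul_of_pos_left h3 hn0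
      _ ≤ _ := mul_le_mul_of_nonneg_right hnT (by positivity)
  constructor
  · have hle : cjsr E A ^ T ≤ gammaStarLift E A T := by
      rw [hG]
      refine le_csInf ⟨_, hfe (cjsr E A + 1) (by linarith)⟩ fun γ hγ => ?_
      have h1 := pow_le_pow_left₀ hρ (lower_bound E A T hT γ hγ) T
      rwa [one_div, Real.rpow_inv_natCast_pow hγ.1.le hT0] at h1
    rw [one_div]
    calc cjsr E A = (cjsr E A ^ T) ^ ((T : ℝ)⁻¹) := (Real.pow_rpow_inv_natCast hρ hT0).symm
      _ ≤ _ := Real.rpow_le_rpow (by positivity) hle (by positivity)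
  · rw [← div_le_iff₀' (by positivity)]
    refine le_of_forall_gt_imp_ge_of_dense fun r hr => ?_
    have hr0 : 0 < r := hρ.trans_lt hr
    rw [div_le_iff₀' (by positivity)]
    exact root_le hT0 hG0 (by positivity) (csInf_le hbb (hfe r hr))
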